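/- At every critical moment during sorting by t stacks in series, each element of the permutation is at least as far left under the left-greedy algorithm as it is under the right-greedy algorithm at the corresponding critical moment (treating the output as leftmost and the input as rightmost). -/

import Mathlib

/-- A configuration for sorting with `t` stacks in series: the remaining input,
the stacks (index `0` is the leftmost, next to the output; index `t-1` is the
rightmost, next to the input; the head of each list is the top of the stack),
and the output produced so far. -/
structure Conf where
  input : List ℕ
  stks : List (List ℕ)
  output : List ℕ
deriving DecidableEq, Repr

/-- `x` may be placed on top of a stack iff the stack is empty or `x` is smaller
than the current top (stacks are increasing from top to bottom). -/
def canPush (x : ℕ) : List ℕ → Bool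
  | [] => true
  | y :: _ => decide (x < y)

/-- Moves, ordered left to right: `0` = pop the leftmost stack to the output
(legal only for the next element of the identity); `m` with `0 < m < t` = move the
top of stack `m` one stack to the left; `t` = push the next input element onto the
rightmost stack. -/
def legal (t : ℕ) (c : Conf) (m : ℕ) : Bool :=
  if m = 0 then
    match c.stks.getD 0 [] with
    | x :: _ => x == c.output.length + 1
    | [] => false
  else if m < t then
    match c.stks.getD m [] with
    | x :: _ => canPush x (c.stks.getD (m-1) [])
    | [] => false
  else if m = t then
    match c.input with
    | x :: _ => canPush x (c.stks.getD (t-1) [])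
    | [] => false
  else false

/-- Perform move `m` on configuration `c` (with `t` stacks). -/
def applyMove (t : ℕ) (c : Conf) (m : ℕ) : Conf :=
  if m = 0 then
    match c.stks.getD 0 [] with
    | x :: s => ⟨c.input, c.stks.set 0 s, c.output ++ [x]⟩
    | [] => c
  else if m < t then
    match c.stks.getD m [] with
    | x :: s => ⟨c.input, (c.stks.set m s).set (m-1) (x :: c.stks.getD (m-1) []), c.output⟩
    | [] => c
  else
    match c.input with
    | x :: rest => ⟨rest, c.stks.set (t-1) (x :: c.stks.getD (t-1) []), c.output⟩
    | [] => c

def initConf (t : ℕ) (p : List ℕ) : Conf := ⟨p, List.replicate t [], []⟩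

/-- The fully sorted configuration: empty input and stacks, output `1,2,...,n`. -/
def finalConf (t n : ℕ) : Conf := ⟨[], List.replicate t [], List.range' 1 n⟩

/-- Run a sequence of moves, requiring each to be legal. -/
def runLegal (t : ℕ) : Conf → List ℕ → Option Conf
  | c, [] => some c
  | c, m :: ms => if legal t c m then runLegal t (applyMove t c m) ms else none

/-- `p` is sortable by `t` stacks in series by some sequence of legal moves. -/
def Sortable (t : ℕ) (p : List ℕ) : Prop :=
  ∃ ms : List ℕ, runLegal t (initConf t p) ms = some (finalConf t p.length)

/-- The leftmost legal move, if any. -/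
def leftMove (t : ℕ) (c : Conf) : Option ℕ :=
  ((List.range (t+1)).filter (fun m => legal t c m)).head?

/-- The rightmost legal move, if any. -/
def rightMove (t : ℕ) (c : Conf) : Option ℕ :=
  ((List.range (t+1)).filter (fun m => legal t c m)).getLast?

/-- One step of a greedy algorithm given by the move selector `mv`
(the configuration is unchanged if no move is legal, i.e. the algorithm fails or is done). -/
def greedyStep (mv : ℕ → Conf → Option ℕ) (t : ℕ) (c : Conf) : Conf :=
  match mv t c with
  | some m => applyMove t c m
  | none => c

/-- The greedy algorithm given by `mv` sorts `p` with `t` stacks in series. -/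
def GreedySorts (mv : ℕ → Conf → Option ℕ) (t : ℕ) (p : List ℕ) : Prop :=
  ∃ k : ℕ, (greedyStep mv t)^[k] (initConf t p) = finalConf t p.length

def LeftGreedySorts : ℕ → List ℕ → Prop := GreedySorts leftMove
def RightGreedySorts : ℕ → List ℕ → Prop := GreedySorts rightMove

/-- `p` is a permutation of `1,...,n` (as a list). -/
def IsPermOf (n : ℕ) (p : List ℕ) : Prop := p.Perm (List.range' 1 n)

/-- The position of the element `x` in configuration `c`: `0` if in the output
(furthest left), `j+1` if in stack `j`, `t+1` if still in the input (furthest right). -/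
def posOf (t : ℕ) (c : Conf) (x : ℕ) : ℕ :=
  if x ∈ c.output then 0
  else match (List.range t).find? (fun j => decide (x ∈ c.stks.getD j [])) with
    | some j => j + 1
    | none => t + 1

/-- `c` is at the `i`-th critical moment for the greedy algorithm `mv` on a
permutation of length `n`: either the chosen move is the entry of the `i`-th
element into the stacks, or the algorithm fails (no legal move, incomplete output). -/
def IsCrit (mv : ℕ → Conf → Option ℕ) (t i n : ℕ) (c : Conf) : Prop :=
  (c.input.length + i = n + 1 ∧ mv t c = some t) ∨
  (mv t c = none ∧ c.output.length < n)

/-- `c` is the configuration at the `i`-th critical moment of the greedy algorithm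
`mv` run on `p` (the first moment along the run satisfying `IsCrit`). -/
def CritConf (mv : ℕ → Conf → Option ℕ) (t i n : ℕ) (p : List ℕ) (c : Conf) : Prop :=
  ∃ k : ℕ, (greedyStep mv t)^[k] (initConf t p) = c ∧ IsCrit mv t i n c ∧
    ∀ k' < k, ¬ IsCrit mv t i n ((greedyStep mv t)^[k'] (initConf t p))

/-- No stack is empty while some stack to its right is nonempty. -/
def NoGap (t : ℕ) (c : Conf) : Prop :=
  ∀ j j' : ℕ, j < j' → j' < t → c.stks.getD j' [] ≠ [] → c.stks.getD j [] ≠ []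

/-- `r` contains `q` as a pattern. -/
def ContainsPat (r q : List ℕ) : Prop :=
  ∃ f : Fin q.length → Fin r.length, StrictMono f ∧
    ∀ a b : Fin q.length, q.get a < q.get b ↔ r.get (f a) < r.get (f b)

/-- The contents of position `j` of a configuration: the output (last element first) for `0`,
stack `j - 1` for `1 ≤ j ≤ t`, the input for `t + 1`. -/
def loc (t : ℕ) (c : Conf) (j : ℕ) : List ℕ :=
  if j = 0 then c.output.reverse
  else if j ≤ t then c.stks.getD (j - 1) []
  else if j = t + 1 then c.input else []

/-- Legality of the move from position `m + 1` to position `m`. -/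
def Leg (t : ℕ) (f : ℕ → List ℕ) (m : ℕ) : Prop :=
  m ≤ t ∧ ∃ x s, f (m + 1) = x :: s ∧
    (if m = 0 then x = (f 0).length + 1 else canPush x (f m) = true)

/-- `g` arises from `f` by moving the top `x` of position `m + 1` to position `m`. -/
def Move (f : ℕ → List ℕ) (m x : ℕ) (g : ℕ → List ℕ) : Prop :=
  f (m + 1) = x :: g (m + 1) ∧ g m = x :: f m ∧ ∀ j, j ≠ m → j ≠ m + 1 → g j = f j

/-- Every element of `f` is at least as far left as in `g`. -/
def LeftOf (f g : ℕ → List ℕ) : Prop := ∀ x a b, x ∈ f a → x ∈ g b → a ≤ b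

/-- The invariants of the arrangements arising while sorting `p`. -/
structure Valid (t : ℕ) (p : List ℕ) (f : ℕ → List ℕ) : Prop where
  mem_iff : ∀ x, x ∈ p ↔ ∃ j, x ∈ f j
  bound : ∀ x j, x ∈ f j → j ≤ t + 1
  uniq : ∀ x a b, x ∈ f a → x ∈ f b → a = b
  nodup : ∀ j, (f j).Nodup
  sorted : ∀ j, 1 ≤ j → j ≤ t → (f j).Pairwise (· < ·)
  out : ∀ x, x ∈ f 0 ↔ 1 ≤ x ∧ x ≤ (f 0).length
  input : f (t + 1) <:+ p

theorem canPush_iff {x : ℕ} {s : List ℕ} (hs : s.Pairwise (· < ·)) :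
    canPush x s = true ↔ ∀ y ∈ s, x < y := by
  cases s with
  | nil => simp [canPush]
  | cons y s =>
    simp only [List.pairwise_cons] at hs
    simp only [canPush, decide_eq_true_eq, List.mem_cons, forall_eq_or_imp]
    exact ⟨fun h => ⟨h, fun z hz => h.trans (hs.1 z hz)⟩, fun h => h.1⟩

theorem Move.mem_or {f g : ℕ → List ℕ} {m x y b : ℕ} (h : Move f m x g) (hy : y ∈ g b) :
    y ∈ f b ∨ (y = x ∧ b = m) := by
  obtain ⟨h1, h2, h3⟩ := h
  by_cases hb : b = m
  · subst hb; rw [h2] at hy; simp at hy; tauto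
  · by_cases hb' : b = m + 1
    · subst hb'; left; rw [h1]; exact List.mem_cons_of_mem _ hy
    · left; rw [← h3 b hb hb']; exact hy

theorem Move.mem_of {f g : ℕ → List ℕ} {m x y b : ℕ} (h : Move f m x g) (hy : y ∈ f b) :
    y ∈ g b ∨ (y = x ∧ b = m + 1) := by
  obtain ⟨h1, h2, h3⟩ := h
  by_cases hb : b = m
  · subst hb; left; rw [h2]; exact List.mem_cons_of_mem _ hy
  · by_cases hb' : b = m + 1
    · subst hb'; rw [h1] at hy; simp at hy; tauto
    · left; rw [h3 b hb hb']; exact hy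

theorem Move.mem_source {f g : ℕ → List ℕ} {m x : ℕ} (h : Move f m x g) : x ∈ f (m + 1) := by
  rw [h.1]; exact List.mem_cons_self

theorem Move.mem_target {f g : ℕ → List ℕ} {m x : ℕ} (h : Move f m x g) : x ∈ g m := by
  rw [h.2.1]; exact List.mem_cons_self

/-- The legality condition, expressed for a move that is performed. -/
theorem Leg.of_move {t : ℕ} {f g : ℕ → List ℕ} {m x : ℕ} (hl : Leg t f m) (h : Move f m x g) :
    m ≤ t ∧ (if m = 0 then x = (f 0).length + 1 else canPush x (f m) = true) := by
  obtain ⟨hm, y, s, h1, h2⟩ := hl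
  rw [h.1] at h1
  obtain ⟨rfl, -⟩ := List.cons.inj h1
  exact ⟨hm, h2⟩

theorem Valid.move {t : ℕ} {p : List ℕ} {f g : ℕ → List ℕ} {m x : ℕ} (hf : Valid t p f)
    (hl : Leg t f m) (h : Move f m x g) : Valid t p g := by
  obtain ⟨hm, hc⟩ := hl.of_move h
  have hx : x ∉ g (m + 1) := by
    have := hf.nodup (m + 1)
    rw [h.1] at this
    exact (List.nodup_cons.1 this).1
  have hxf : ∀ j, x ∈ f j → j = m + 1 := fun j hj => hf.uniq x _ _ hj h.mem_source
  have hxm : x ∉ f m := fun hj => by have := hxf _ hj; omega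
  have hxg : ∀ j, x ∈ g j → j = m := by
    intro j hj
    rcases h.mem_or hj with h' | h'
    · have := hxf j h'; subst this; exact absurd hj hx
    · exact h'.2
  refine ⟨?_, ?_, ?_, ?_, ?_, ?_, ?_⟩
  · intro y
    rw [hf.mem_iff]
    constructor
    · rintro ⟨j, hj⟩
      rcases h.mem_of hj with h' | ⟨rfl, -⟩
      · exact ⟨j, h'⟩
      · exact ⟨m, h.mem_target⟩
    · rintro ⟨j, hj⟩
      rcases h.mem_or hj with h' | ⟨rfl, -⟩
      · exact ⟨j, h'⟩
      · exact ⟨m + 1, h.mem_source⟩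
  · intro y j hj
    rcases h.mem_or hj with h' | ⟨rfl, rfl⟩
    · exact hf.bound _ _ h'
    · omega
  · intro y a b ha hb
    by_cases hy : y = x
    · subst hy; rw [hxg a ha, hxg b hb]
    · rcases h.mem_or ha with h1 | h1 <;> rcases h.mem_or hb with h2 | h2
      · exact hf.uniq y _ _ h1 h2
      all_goals tauto
  · intro j
    by_cases hj : j = m
    · subst hj; rw [h.2.1]; exact List.nodup_cons.2 ⟨hxm, hf.nodup _⟩
    · by_cases hj' : j = m + 1
      · subst hj'
        have := hf.nodup (m + 1)
        rw [h.1] at this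
        exact (List.nodup_cons.1 this).2
      · rw [h.2.2 j hj hj']; exact hf.nodup j
  · intro j h1 h2
    by_cases hj : j = m
    · subst hj
      rw [if_neg (by omega), canPush_iff (hf.sorted j h1 h2)] at hc
      rw [h.2.1]; exact List.pairwise_cons.2 ⟨hc, hf.sorted _ h1 h2⟩
    · by_cases hj' : j = m + 1
      · subst hj'
        have := hf.sorted (m + 1) h1 h2
        rw [h.1] at this
        exact (List.pairwise_cons.1 this).2
      · rw [h.2.2 j hj hj']; exact hf.sorted j h1 h2
  · intro y
    by_cases h0 : m = 0
    · subst h0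
      rw [if_pos rfl] at hc
      rw [h.2.1, List.mem_cons, hf.out, List.length_cons]
      omega
    · rw [h.2.2 0 (by omega) (by omega)]; exact hf.out y
  · by_cases hj : m = t
    · subst hj
      have := hf.input
      rw [h.1] at this
      exact (List.suffix_cons _ _).trans this
    · rw [h.2.2 (t + 1) (by omega) (by omega)]; exact hf.input

theorem LeftOf.move {t : ℕ} {p : List ℕ} {f g : ℕ → List ℕ} {m x : ℕ} (hf : Valid t p f)
    (h : Move f m x g) : LeftOf g f := by
  intro y a b ha hb
  rcases h.mem_or ha with h1 | ⟨rfl, rfl⟩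
  · exact (hf.uniq y a b h1 hb).le
  · have := hf.uniq y _ _ hb h.mem_source
    omega

theorem LeftOf.trans {t : ℕ} {p : List ℕ} {f g h : ℕ → List ℕ} (hf : Valid t p f)
    (hg : Valid t p g) (h1 : LeftOf f g) (h2 : LeftOf g h) : LeftOf f h := by
  intro y a b ha hb
  obtain ⟨d, hd⟩ := (hg.mem_iff y).1 ((hf.mem_iff y).2 ⟨a, ha⟩)
  exact (h1 y a d ha hd).trans (h2 y d b hd hb)

theorem Valid.input_eq {t : ℕ} {p : List ℕ} {f g : ℕ → List ℕ} (hf : Valid t p f)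
    (hg : Valid t p g) (h : (f (t + 1)).length = (g (t + 1)).length) :
    f (t + 1) = g (t + 1) :=
  (List.suffix_of_suffix_length_le hf.input hg.input h.le).eq_of_length h

/-- If the head of position `b + 1` cannot move, some smaller element lies at position `b`. -/
theorem Valid.exists_blocking {t : ℕ} {p : List ℕ} {f : ℕ → List ℕ} {b x : ℕ} {s : List ℕ}
    (hf : Valid t p f) (hb : 1 ≤ b) (hbt : b ≤ t) (hx : f (b + 1) = x :: s)
    (hl : ¬ Leg t f b) : ∃ z ∈ f b, z < x := by
  by_contra! hcon
  refine hl ⟨hbt, x, s, hx, ?_⟩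
  rw [if_neg (by omega), canPush_iff (hf.sorted b hb hbt)]
  intro y hy
  refine lt_of_le_of_ne (hcon y hy) ?_
  rintro rfl
  have := hf.uniq x b (b + 1) hy (by rw [hx]; exact List.mem_cons_self)
  omega

/-- If `x` tops position `m + 1` and all moves further right are illegal, the stacks further
right contain nothing smaller than `x`. -/
theorem Valid.not_lt_of_right_blocked {t : ℕ} {p : List ℕ} {f : ℕ → List ℕ} {m x : ℕ}
    {s : List ℕ} (hf : Valid t p f) (hx : f (m + 1) = x :: s)
    (hr : ∀ m', m < m' → ¬ Leg t f m') (d z : ℕ) (hz : z ∈ f (m + 1 + d))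
    (hd : m + 1 + d ≤ t) : x ≤ z := by
  induction d generalizing z with
  | zero =>
    have hs := hf.sorted (m + 1) (by omega) (by omega)
    rw [Nat.add_zero, hx] at hz
    rw [hx, List.pairwise_cons] at hs
    rcases List.mem_cons.1 hz with rfl | h
    · exact le_rfl
    · exact (hs.1 z h).le
  | succ d ih =>
    have hs := hf.sorted (m + 1 + (d + 1)) (by omega) hd
    obtain ⟨w, s', hw⟩ := List.exists_cons_of_ne_nil (List.ne_nil_of_mem hz)
    rw [hw, List.pairwise_cons] at hs
    obtain ⟨v, hv, hvw⟩ := hf.exists_blocking (b := m + 1 + d) (by omega) (by omega) hw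
      (hr _ (by omega))
    have hxv := ih v hv (by omega)
    rw [hw] at hz
    rcases List.mem_cons.1 hz with rfl | h
    · omega
    · have := hs.1 z h; omega

/-- A rightmost legal move that is not an entry keeps an arrangement to the right of an
arrangement, with the same input, in which only an entry may be legal. -/
theorem LeftOf.rightmost_move {t : ℕ} {p : List ℕ} (hp : ∀ x ∈ p, 1 ≤ x)
    {l r r' : ℕ → List ℕ} {m x : ℕ}
    (hl : Valid t p l) (hr : Valid t p r) (hin : l (t + 1) = r (t + 1))
    (hsat : ∀ m < t, ¬ Leg t l m) (hm : m < t) (hleg : Leg t r m)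
    (hright : ∀ m', m < m' → ¬ Leg t r m') (hmv : Move r m x r') (hle : LeftOf l r) :
    LeftOf l r' := by
  intro y a b ha hb
  rcases hmv.mem_or hb with h | ⟨rfl, rfl⟩
  · exact hle y a b ha h
  have ham := hle y a _ ha hmv.mem_source
  by_contra hab
  obtain rfl : a = b + 1 := by omega
  obtain ⟨-, hc⟩ := hleg.of_move hmv
  have hs := hl.sorted (b + 1) (by omega) (by omega)
  obtain ⟨w, s, hw⟩ := List.exists_cons_of_ne_nil (List.ne_nil_of_mem ha)
  rw [hw, List.pairwise_cons] at hs
  have hwl : w ∈ l (b + 1) := by rw [hw]; exact List.mem_cons_self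
  have hwy : w = y ∨ w < y := by
    rw [hw] at ha
    rcases List.mem_cons.1 ha with h | h
    · exact Or.inl h.symm
    · exact Or.inr (hs.1 y h)
  by_cases h0 : b = 0
  · subst h0
    rw [if_pos rfl] at hc
    rcases hwy with rfl | hlt
    · apply hsat 0 hm
      refine ⟨by omega, w, s, hw, ?_⟩
      rw [if_pos rfl]
      have h1 : ¬ w ≤ (l 0).length := by
        intro h
        have := hl.uniq w 0 1 ((hl.out w).2 ⟨by omega, h⟩) ha
        omega
      by_contra h2
      have h3 : (l 0).length + 1 ∈ r 0 := (hr.out _).2 ⟨by omega, by omega⟩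
      obtain ⟨d, hd⟩ := (hl.mem_iff _).1 ((hr.mem_iff _).2 ⟨0, h3⟩)
      obtain rfl : d = 0 := by have := hle _ _ _ hd h3; omega
      have := (hl.out _).1 hd
      omega
    · have h1 := hp w ((hl.mem_iff w).2 ⟨_, hwl⟩)
      have := hle w _ _ hwl ((hr.out w).2 ⟨h1, by omega⟩)
      omega
  · rw [if_neg h0, canPush_iff (hr.sorted b (by omega) (by omega))] at hc
    obtain ⟨z, e, hz, hzy, he, he'⟩ : ∃ z e, z ∈ l e ∧ z < y ∧ b ≤ e ∧ e ≤ b + 1 := by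
      rcases hwy with rfl | hlt
      · obtain ⟨z, hz, hzw⟩ := hl.exists_blocking (by omega) (by omega) hw (hsat b hm)
        exact ⟨z, b, hz, hzw, le_rfl, by omega⟩
      · exact ⟨w, b + 1, hwl, hlt, by omega, le_rfl⟩
    obtain ⟨d, hd⟩ := (hr.mem_iff z).1 ((hl.mem_iff z).2 ⟨e, hz⟩)
    have hed := hle z e d hz hd
    have hdt := hr.bound _ _ hd
    rcases Nat.lt_or_ge b d with hbd | hbd
    · rcases Nat.lt_or_ge t d with htd | htd
      · obtain rfl : d = t + 1 := by omega
        rw [← hin] at hd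
        have := hl.uniq z _ _ hz hd
        omega
      · have := hr.not_lt_of_right_blocked hmv.1 hright (d - (b + 1)) z
          (by rwa [show b + 1 + (d - (b + 1)) = d by omega]) (by omega)
        omega
    · obtain rfl : d = b := by omega
      have := hc z hd
      omega

theorem legal_iff {t : ℕ} (ht : 0 < t) (c : Conf) (m : ℕ) :
    legal t c m = true ↔ Leg t (loc t c) m := by
  unfold legal Leg
  by_cases h0 : m = 0
  · subst h0
    have h1 : loc t c 1 = c.stks.getD 0 [] := by
      simp [loc, show 1 ≤ t from ht]
    have h2 : (loc t c 0).length = c.output.length := by simp [loc]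
    rw [Nat.zero_add, h1, h2]
    simp only [if_true]
    cases c.stks.getD 0 [] <;> simp
  have hm : ∀ h : m ≤ t, loc t c m = c.stks.getD (m - 1) [] := by
    intro h; simp [loc, h0, h]
  by_cases h1 : m < t
  · have h2 : loc t c (m + 1) = c.stks.getD m [] := by
      simp [loc, show m + 1 ≤ t from h1]
    rw [h2, hm h1.le]
    simp only [h0, h1, h1.le, if_true, if_false, true_and]
    cases c.stks.getD m [] <;> simp
  · by_cases h2 : m = t
    · subst h2
      have h3 : loc m c (m + 1) = c.input := by simp [loc]
      rw [h3, hm le_rfl]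
      simp only [h0, lt_irrefl, le_refl, if_true, if_false, true_and]
      cases c.input <;> simp
    · simp only [h0, h1, h2, if_false]
      simp
      omega

theorem applyMove_stks_length (t : ℕ) (c : Conf) (m : ℕ) :
    (applyMove t c m).stks.length = c.stks.length := by
  unfold applyMove
  split_ifs <;> split <;> simp

theorem exists_move {t : ℕ} (ht : 0 < t) {c : Conf} (hc : c.stks.length = t) {m : ℕ}
    (hl : Leg t (loc t c) m) : ∃ x, Move (loc t c) m x (loc t (applyMove t c m)) := by
  obtain ⟨hm, x, s, hx, -⟩ := hl
  refine ⟨x, ?_⟩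
  by_cases h0 : m = 0
  · subst h0
    have h1 : c.stks.getD 0 [] = x :: s := by
      rw [← hx]; simp [loc, show 1 ≤ t from ht]
    have h2 : applyMove t c 0 = ⟨c.input, c.stks.set 0 s, c.output ++ [x]⟩ := by
      simp only [applyMove, if_true, h1]
    rw [h2]
    refine ⟨?_, ?_, ?_⟩
    · rw [hx]; simp [loc, show 1 ≤ t from ht, List.getD_eq_getElem?_getD, hc, ht]
    · simp [loc]
    · intro j hj hj'
      simp only [loc, hj, if_false]
      split_ifs
      · simp [List.getD_eq_getElem?_getD, show 0 ≠ j - 1 by omega]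
      · rfl
      · rfl
  by_cases h1 : m < t
  · have h2 : c.stks.getD m [] = x :: s := by
      rw [← hx]; simp [loc, show m + 1 ≤ t from h1]
    have h3 : applyMove t c m =
        ⟨c.input, (c.stks.set m s).set (m-1) (x :: c.stks.getD (m-1) []), c.output⟩ := by
      simp only [applyMove, if_true, if_false, h0, h1, h2]
    rw [h3]
    refine ⟨?_, ?_, ?_⟩
    · rw [hx]
      simp [loc, show m + 1 ≤ t from h1, List.getD_eq_getElem?_getD, hc, h1, show m - 1 ≠ m by omega]
    · simp [loc, h0, h1.le, List.getD_eq_getElem?_getD, hc,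
        show m - 1 < t by omega]
    · intro j hj hj'
      by_cases hj0 : j = 0
      · simp [loc, hj0]
      simp only [loc, hj0, if_false]
      split_ifs
      · simp [List.getD_eq_getElem?_getD, show m - 1 ≠ j - 1 by omega,
          show m ≠ j - 1 by omega]
      · rfl
      · rfl
  · obtain rfl : m = t := by omega
    have h2 : c.input = x :: s := by rw [← hx]; simp [loc]
    have h3 : applyMove m c m =
        ⟨s, c.stks.set (m-1) (x :: c.stks.getD (m-1) []), c.output⟩ := by
      simp only [applyMove, lt_irrefl, if_false, h0, h2]
    rw [h3]
    refine ⟨?_, ?_, ?_⟩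
    · rw [hx]; simp [loc]
    · simp [loc, h0, List.getD_eq_getElem?_getD, hc, show m - 1 < m by omega]
    · intro j hj hj'
      by_cases hj0 : j = 0
      · simp [loc, hj0]
      simp only [loc, hj0, hj', if_false]
      split_ifs
      · simp [List.getD_eq_getElem?_getD, show m - 1 ≠ j - 1 by omega]
      · rfl

theorem valid_init {t : ℕ} {p : List ℕ} (hp : p.Nodup) : Valid t p (loc t (initConf t p)) := by
  have h : ∀ j, loc t (initConf t p) j = if j = t + 1 then p else [] := by
    intro j
    by_cases h0 : j = 0
    · simp [h0, loc, initConf]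
    · by_cases h1 : j ≤ t
      · simp [loc, initConf, h0, h1, show j ≠ t + 1 by omega, List.getD_eq_getElem?_getD, show j - 1 < t by omega]
      · simp [loc, initConf, h0, h1]
  have hmem : ∀ x j, x ∈ loc t (initConf t p) j ↔ j = t + 1 ∧ x ∈ p := by
    intro x j; rw [h]; split_ifs with hj <;> simp [hj]
  refine ⟨?_, ?_, ?_, ?_, ?_, ?_, ?_⟩
  · simp [hmem]
  · intro x j hj; exact ((hmem x j).1 hj).1.le
  · intro x a b ha hb; rw [((hmem x a).1 ha).1, ((hmem x b).1 hb).1]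
  · intro j; rw [h]; split_ifs <;> simp [hp]
  · intro j h1 h2; rw [h, if_neg (by omega)]; exact List.Pairwise.nil
  · intro x; rw [h, if_neg (by omega)]; simp; omega
  · rw [h, if_pos rfl]

/-- A move selector that chooses legal moves whenever there are any. -/
def Selects (t : ℕ) (mv : ℕ → Conf → Option ℕ) : Prop :=
  ∀ c, (∀ m, mv t c = some m → Leg t (loc t c) m) ∧
    (mv t c = none → ∀ m, ¬ Leg t (loc t c) m)

theorem mem_legalMoves {t : ℕ} (ht : 0 < t) (c : Conf) (m : ℕ) :
    m ∈ (List.range (t+1)).filter (fun m => legal t c m) ↔ Leg t (loc t c) m := by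
  rw [List.mem_filter, List.mem_range, legal_iff ht]
  exact ⟨fun h => h.2, fun h => ⟨Nat.lt_succ_of_le h.1, h⟩⟩

theorem pairwise_legalMoves (t : ℕ) (c : Conf) :
    ((List.range (t+1)).filter (fun m => legal t c m)).Pairwise (· < ·) :=
  List.Pairwise.filter _ List.pairwise_lt_range

theorem selects_leftMove {t : ℕ} (ht : 0 < t) : Selects t leftMove := by
  refine fun c => ⟨fun m hm => ?_, fun hm m hl => ?_⟩
  · exact (mem_legalMoves ht c m).1 (List.mem_of_mem_head? hm)
  · rw [leftMove, List.head?_eq_none_iff] at hm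
    rw [← mem_legalMoves ht, hm] at hl
    simp at hl

theorem selects_rightMove {t : ℕ} (ht : 0 < t) : Selects t rightMove := by
  refine fun c => ⟨fun m hm => ?_, fun hm m hl => ?_⟩
  · exact (mem_legalMoves ht c m).1 (List.mem_of_getLast? hm)
  · rw [rightMove, List.getLast?_eq_none_iff] at hm
    rw [← mem_legalMoves ht, hm] at hl
    simp at hl

theorem not_leg_of_lt_leftMove {t : ℕ} (ht : 0 < t) {c : Conf} {m m' : ℕ}
    (h : leftMove t c = some m) (hm : m' < m) : ¬ Leg t (loc t c) m' := by
  intro hl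
  rw [← mem_legalMoves ht] at hl
  have hs := pairwise_legalMoves t c
  obtain ⟨s, hs'⟩ := List.head?_eq_some_iff.1 h
  rw [hs'] at hl hs
  rcases List.mem_cons.1 hl with h | h
  · omega
  · have := (List.pairwise_cons.1 hs).1 _ h
    omega

theorem not_leg_of_rightMove_lt {t : ℕ} (ht : 0 < t) {c : Conf} {m m' : ℕ}
    (h : rightMove t c = some m) (hm : m < m') : ¬ Leg t (loc t c) m' := by
  intro hl
  rw [← mem_legalMoves ht] at hl
  have hs := pairwise_legalMoves t c
  obtain ⟨s, hs'⟩ := List.getLast?_eq_some_iff.1 h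
  rw [hs'] at hl hs
  rcases List.mem_append.1 hl with h | h
  · have := (List.pairwise_append.1 hs).2.2 _ h m (by simp)
    omega
  · simp at h; omega

/-- The configuration after `k` steps of the greedy algorithm. -/
def run (mv : ℕ → Conf → Option ℕ) (t : ℕ) (p : List ℕ) (k : ℕ) : Conf :=
  (greedyStep mv t)^[k] (initConf t p)

theorem run_succ (mv : ℕ → Conf → Option ℕ) (t : ℕ) (p : List ℕ) (k : ℕ) :
    run mv t p (k + 1) = greedyStep mv t (run mv t p k) :=
  Function.iterate_succ_apply' _ _ _

theorem run_stks_length (mv : ℕ → Conf → Option ℕ) (t : ℕ) (p : List ℕ) (k : ℕ) :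
    (run mv t p k).stks.length = t := by
  induction k with
  | zero => simp [run, initConf]
  | succ k ih =>
    rw [run_succ, greedyStep]
    split
    · rw [applyMove_stks_length, ih]
    · exact ih

theorem Selects.run_step {mv : ℕ → Conf → Option ℕ} {t : ℕ} (hmv : Selects t mv) (ht : 0 < t)
    (p : List ℕ) (k : ℕ) :
    (mv t (run mv t p k) = none ∧ run mv t p (k + 1) = run mv t p k) ∨
    ∃ m x, mv t (run mv t p k) = some m ∧ Leg t (loc t (run mv t p k)) m ∧
      Move (loc t (run mv t p k)) m x (loc t (run mv t p (k + 1))) := by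
  rw [run_succ, greedyStep]
  cases h : mv t (run mv t p k) with
  | none => simp
  | some m =>
    have hl := (hmv _).1 m h
    obtain ⟨x, hx⟩ := exists_move ht (run_stks_length mv t p k) hl
    exact Or.inr ⟨m, x, rfl, hl, hx⟩

theorem Selects.valid {mv : ℕ → Conf → Option ℕ} {t : ℕ} (hmv : Selects t mv) (ht : 0 < t)
    {p : List ℕ} (hp : p.Nodup) (k : ℕ) : Valid t p (loc t (run mv t p k)) := by
  induction k with
  | zero => exact valid_init hp
  | succ k ih =>
    rcases hmv.run_step ht p k with ⟨-, h⟩ | ⟨m, x, -, hl, hm⟩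
    · rwa [h]
    · exact ih.move hl hm

theorem Selects.leftOf {mv : ℕ → Conf → Option ℕ} {t : ℕ} (hmv : Selects t mv) (ht : 0 < t)
    {p : List ℕ} (hp : p.Nodup) {k k' : ℕ} (hk : k ≤ k') :
    LeftOf (loc t (run mv t p k')) (loc t (run mv t p k)) := by
  induction k', hk using Nat.le_induction with
  | base => intro x a b ha hb; exact ((hmv.valid ht hp k).uniq x a b ha hb).le
  | succ k' _ ih =>
    rcases hmv.run_step ht p k' with ⟨-, h⟩ | ⟨m, x, -, hl, hm⟩
    · rwa [h]
    · have hv := hmv.valid ht hp k'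
      exact (LeftOf.move hv hm).trans (hv.move hl hm) hv ih

theorem loc_input (t : ℕ) (c : Conf) : loc t c (t + 1) = c.input := by simp [loc]

/-- Every input length is left by an entry move. -/
theorem Selects.exists_entry {mv : ℕ → Conf → Option ℕ} {t : ℕ} (hmv : Selects t mv)
    (ht : 0 < t) {p : List ℕ} {q : ℕ} (hq : q ≤ p.length) {k : ℕ}
    (hk : (run mv t p k).input.length < q) :
    ∃ k' < k, (run mv t p k').input.length = q ∧ mv t (run mv t p k') = some t := by
  induction k with
  | zero => simp [run, initConf] at hk; omega
  | succ k ih =>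
    by_cases h : (run mv t p k).input.length < q
    · obtain ⟨k', h1, h2⟩ := ih h
      exact ⟨k', by omega, h2⟩
    · rcases hmv.run_step ht p k with ⟨-, h'⟩ | ⟨m, x, hs, hl, hm⟩
      · rw [h'] at hk; omega
      · by_cases hmt : m = t
        · subst hmt
          refine ⟨k, by omega, ?_, hs⟩
          have := congrArg List.length hm.1
          simp only [loc_input, List.length_cons] at this
          omega
        · have := hm.2.2 (t + 1) (by have := hl.1; omega) (by omega)
          rw [loc_input, loc_input] at this
          rw [this] at hk
          omega

/-- A left-greedy configuration in which only an entry may be legal lies to the left of every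
right-greedy configuration with the same input. -/
theorem leftOf_run {t : ℕ} (ht : 0 < t) {p : List ℕ} (hp : p.Nodup) (hp1 : ∀ x ∈ p, 1 ≤ x)
    (k l : ℕ) (hsat : ∀ m < t, ¬ Leg t (loc t (run leftMove t p l)) m)
    (hin : (run leftMove t p l).input.length = (run rightMove t p k).input.length) :
    LeftOf (loc t (run leftMove t p l)) (loc t (run rightMove t p k)) := by
  have hL := selects_leftMove ht
  have hR := selects_rightMove ht
  induction k generalizing l with
  | zero => exact hL.leftOf ht hp (Nat.zero_le l)
  | succ k ih =>
    have hvl := hL.valid ht hp l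
    have hvr := hR.valid ht hp k
    have hvr' := hR.valid ht hp (k + 1)
    rcases hR.run_step ht p k with ⟨-, h⟩ | ⟨m, x, hs, hl, hm⟩
    · rw [h] at hin ⊢; exact ih l hsat hin
    by_cases hmt : m = t
    · subst hmt
      have hlen := congrArg List.length hm.1
      simp only [loc_input, List.length_cons] at hlen
      have hle := hvr.input.length_le
      rw [loc_input] at hle
      obtain ⟨l', hl', hin', hs'⟩ := hL.exists_entry ht hle
        (k := l) (by omega)
      have hvl' := hL.valid ht hp l'
      have h1 := (hL.leftOf ht hp hl'.le).trans hvl hvl'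
        (ih l' (fun m' hm' => not_leg_of_lt_leftMove ht hs' hm') hin')
      intro y a b ha hb
      rcases hm.mem_or hb with h | ⟨rfl, rfl⟩
      · exact h1 y a b ha h
      · have hab := hvl.bound _ _ ha
        by_contra hcon
        obtain rfl : a = b + 1 := by omega
        rw [hvl.input_eq hvr' (by simpa only [loc_input] using hin)] at ha
        have := hvr'.uniq y _ _ ha hb
        omega
    · have hmt' : m < t := lt_of_le_of_ne hl.1 hmt
      have h := hm.2.2 (t + 1) (by omega) (by omega)
      have hin' : (run leftMove t p l).input.length = (run rightMove t p k).input.length := by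
        rw [loc_input, loc_input] at h
        rw [hin, h]
      exact LeftOf.rightmost_move hp1 hvl hvr
        (hvl.input_eq hvr (by simpa only [loc_input] using hin')) hsat hmt' hl
        (fun m' hm' => not_leg_of_rightMove_lt ht hs hm') hm (ih l hsat hin')

theorem mem_loc_posOf {t : ℕ} {c : Conf} {x j : ℕ} (h : x ∈ loc t c j) :
    x ∈ loc t c (posOf t c x) := by
  unfold posOf
  split_ifs with h0
  · simpa [loc] using h0
  · split
    next i hi =>
      have h1 := List.mem_of_find?_eq_some hi
      have h2 := List.find?_some hi
      rw [List.mem_range] at h1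
      simpa [loc, show i + 1 ≤ t from h1] using h2
    next hn =>
      rw [List.find?_eq_none] at hn
      unfold loc at h
      split_ifs at h with h1 h2 h3
      · simp at h; exact absurd h h0
      · exact absurd (by simpa using h) (hn (j - 1) (by rw [List.mem_range]; omega))
      · simpa [loc] using h
      · simp at h

theorem legal_zero_of_stks_nil {c : Conf} (hc : c.stks = []) (m : ℕ) : legal 0 c m = false := by
  unfold legal
  split_ifs <;> simp_all

theorem run_zero {mv : ℕ → Conf → Option ℕ} {p : List ℕ} (hmv : mv 0 (initConf 0 p) = none)
    (k : ℕ) : run mv 0 p k = initConf 0 p := by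
  induction k with
  | zero => rfl
  | succ k ih => rw [run_succ, ih, greedyStep, hmv]

/-- If the left-greedy algorithm is stuck, the right-greedy algorithm cannot enter the next
element either. -/
theorem not_leg_entry_of_leftOf {t : ℕ} (ht : 0 < t) {p : List ℕ} {l r : ℕ → List ℕ}
    (hl : Valid t p l) (hr : Valid t p r) (hin : l (t + 1) = r (t + 1)) (hle : LeftOf l r)
    (hstuck : ¬ Leg t l t) : ¬ Leg t r t := by
  rintro ⟨-, x, s, hx, hc⟩
  rw [if_neg ht.ne', canPush_iff (hr.sorted t ht le_rfl)] at hc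
  obtain ⟨z, hz, hzx⟩ := hl.exists_blocking ht le_rfl (hin.trans hx) hstuck
  obtain ⟨d, hd⟩ := (hr.mem_iff z).1 ((hl.mem_iff z).2 ⟨t, hz⟩)
  have h1 := hle _ _ _ hz hd
  have h2 := hr.bound _ _ hd
  rcases Nat.lt_or_ge t d with h | h
  · obtain rfl : d = t + 1 := by omega
    rw [← hin] at hd
    have := hl.uniq z _ _ hz hd
    omega
  · obtain rfl : d = t := by omega
    have := hc z hd
    omega

/-- At each `i`-th critical moment, every element is at least as far left under the
left-greedy algorithm as under the right-greedy algorithm at its `i`-th critical moment. -/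
theorem stmt4 (t n : ℕ) (p : List ℕ) (hp : IsPermOf n p)
    (i : ℕ) (hi1 : 1 ≤ i) (hin : i ≤ n) (cL cR : Conf)
    (hL : CritConf leftMove t i n p cL) (hR : CritConf rightMove t i n p cR) :
    ∀ x ∈ p, posOf t cL x ≤ posOf t cR x := by
  obtain ⟨l, rfl, hcl, -⟩ := hL
  obtain ⟨k, rfl, hcr, hmin⟩ := hR
  simp only [← run.eq_def] at *
  rcases Nat.eq_zero_or_pos t with rfl | ht
  · have h : ∀ m, legal 0 (initConf 0 p) m = false :=
      legal_zero_of_stks_nil rfl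
    rw [run_zero (by simp [leftMove, h]), run_zero (by simp [rightMove, h])]
    exact fun _ _ => le_rfl
  have hlen : p.length = n := by simpa using hp.length_eq
  have hnd : p.Nodup := hp.nodup_iff.2 List.nodup_range'
  have hp1 : ∀ x ∈ p, 1 ≤ x := fun x hx => (List.mem_range'_1.1 (hp.mem_iff.1 hx)).1
  have sL := selects_leftMove ht
  have sR := selects_rightMove ht
  have vl := sL.valid ht hnd l
  have vr := sR.valid ht hnd k
  have hlel := vl.input.length_le
  have hler := vr.input.length_le
  rw [loc_input] at hlel hler
  have hsat : ∀ m < t, ¬ Leg t (loc t (run leftMove t p l)) m := by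
    rcases hcl with ⟨-, h⟩ | ⟨h, -⟩
    · exact fun m hm => not_leg_of_lt_leftMove ht h hm
    · exact fun m _ => (sL _).2 h m
  have key : LeftOf (loc t (run leftMove t p l)) (loc t (run rightMove t p k)) := by
    rcases lt_trichotomy (run leftMove t p l).input.length (run rightMove t p k).input.length
      with h | h | h
    · obtain ⟨l', hl', hin', hs'⟩ := sL.exists_entry ht hler h
      exact (sL.leftOf ht hnd hl'.le).trans vl (sL.valid ht hnd l')
        (leftOf_run ht hnd hp1 k l' (fun m hm => not_leg_of_lt_leftMove ht hs' hm) hin')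
    · exact leftOf_run ht hnd hp1 k l hsat h
    · exfalso
      obtain ⟨k', hk', hin', hs'⟩ := sR.exists_entry ht hlel h
      rcases hcl with ⟨h1, -⟩ | ⟨h1, -⟩
      · exact hmin k' hk' (Or.inl ⟨by omega, hs'⟩)
      · have vr' := sR.valid ht hnd k'
        exact not_leg_entry_of_leftOf ht vl vr'
          (vl.input_eq vr' (by simpa only [loc_input] using hin'.symm))
          (leftOf_run ht hnd hp1 k' l hsat hin'.symm) ((sL _).2 h1 t) ((sR _).1 t hs')
  intro x hx
  obtain ⟨a, ha⟩ := (vl.mem_iff x).1 hx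
  obtain ⟨b, hb⟩ := (vr.mem_iff x).1 hx
  exact key x _ _ (mem_loc_posOf ha) (mem_loc_posOf hb)
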